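/- Let M be a finite set of goods and let there be n agents, where each agent i has a k_i-demand valuation for some positive integer k_i, that is, v_i(S) = max over subsets T ⊆ S with |T| ≤ k_i of Σ_{g∈T} w_i(g) for some weight function w_i : M → ℝ≥0. Then there exists an allocation with copies (A_1,…,A_n) such that v_i(A_i) ≥ μ_i^n(M) for every agent i, each good belongs to at most two of the bundles, and at most n−1 goods belong to two bundles (i.e., n−1 distinct copies suffice to achieve a full MMS allocation for k-demand valuations). -/

import Mathlib

open Finset

/-- The `d`-maximin share of valuation `v` over the set `S` of goods:
the maximum over partitions of `S` into `d` bundles of the minimum bundle value. -/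
noncomputable def mms {G : Type*} (v : Finset G → ℝ) (d : ℕ) (S : Finset G) : ℝ :=
  ⨆ P : G → Fin d, ⨅ j : Fin d, v (S.filter fun g => P g = j)

/-- The `k`-demand valuation with weights `w`: the value of a set `S` is the maximum total
weight of a subset of `S` of size at most `k`. -/
noncomputable def kDemand {G : Type*} [DecidableEq G] (w : G → ℝ) (k : ℕ)
    (S : Finset G) : ℝ :=
  (S.powerset.filter fun T => T.card ≤ k).sup' ⟨∅, by simp⟩ (fun T => ∑ g ∈ T, w g)

/-- The increasing enumeration of the positions that remain after removing `0` and the positions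
`max (σ + m + 1) ((M + 1) * (m + 1))`, `m ≥ 0`. -/
def skip (M σ p : ℕ) : ℕ := if p < σ then p + 1 else p + 1 + p / M

theorem skip_strictMono (M σ : ℕ) : StrictMono (skip M σ) := by
  refine strictMono_nat_of_lt_succ fun p => ?_
  have h : p / M ≤ (p + 1) / M := Nat.div_le_div_right (by omega)
  unfold skip
  generalize p / M = a at *
  generalize (p + 1) / M = b at *
  split_ifs <;> omega

theorem skip_ne_zero (M σ p : ℕ) : skip M σ p ≠ 0 := by
  unfold skip
  generalize p / M = a
  split_ifs <;> omega

theorem skip_ne_max {M : ℕ} (hM : 1 ≤ M) (σ p m : ℕ) :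
    skip M σ p ≠ max (σ + m + 1) ((M + 1) * (m + 1)) := by
  unfold skip
  split_ifs with hp
  · have := le_max_left (σ + m + 1) ((M + 1) * (m + 1))
    omega
  · have h1 : M * (p / M) ≤ p := Nat.mul_div_le p M
    have h2 : p < M * (p / M + 1) := Nat.lt_mul_div_succ p (by omega)
    set d := p / M
    intro h
    rcases Nat.lt_or_ge m d with hd | hd
    · have h3 : M * (m + 1) ≤ M * d := Nat.mul_le_mul_left M hd
      rcases max_choice (σ + m + 1) ((M + 1) * (m + 1)) with h4 | h4
      · omega
      · rw [h4] at h
        nlinarith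
    · have h3 : M * (d + 1) ≤ M * (m + 1) := Nat.mul_le_mul_left M (by omega)
      have h4 := le_max_right (σ + m + 1) ((M + 1) * (m + 1))
      nlinarith

theorem strictMono_max_add_mul (N σ : ℕ) (hN : 1 ≤ N) :
    StrictMono fun m : ℕ => max (σ + m + 1) (N * (m + 1)) := by
  refine strictMono_nat_of_lt_succ fun m => ?_
  have : N * (m + 1) < N * (m + 1 + 1) := by nlinarith
  simp only [max_lt_iff, lt_max_iff]
  omega

/-- After one agent leaves with a bag, the positions `skip M σ p` together with the bag
exhaust the first `(M + 1) * (q + 1)` positions. -/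
theorem sum_range_eq_skip_add {M : ℕ} (hM : 1 ≤ M) {σ q : ℕ} (hσ : σ < M * (q + 1))
    (u : ℕ → ℝ) :
    ∑ p ∈ range ((M + 1) * (q + 1)), u p =
      ∑ p ∈ range (M * (q + 1)), u (skip M σ p) +
        (u 0 + ∑ m ∈ range q, u (max (σ + m + 1) ((M + 1) * (m + 1)))) := by
  have hb := strictMono_max_add_mul (M + 1) σ (by omega)
  have e1 : ∑ p ∈ range (M * (q + 1)), u (skip M σ p) =
      ∑ p ∈ (range (M * (q + 1))).image (skip M σ), u p :=
    (sum_image fun a _ b _ h => (skip_strictMono M σ).injective h).symm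
  have e2 : ∑ m ∈ range q, u (max (σ + m + 1) ((M + 1) * (m + 1))) =
      ∑ p ∈ (range q).image fun m => max (σ + m + 1) ((M + 1) * (m + 1)), u p :=
    (sum_image fun a _ b _ h => hb.injective h).symm
  have n0 : 0 ∉ (range q).image fun m => max (σ + m + 1) ((M + 1) * (m + 1)) := by
    simp
  have hd : Disjoint ((range (M * (q + 1))).image (skip M σ))
      (insert 0 ((range q).image fun m => max (σ + m + 1) ((M + 1) * (m + 1)))) := by
    rw [disjoint_left]
    intro x hx hx'
    obtain ⟨p, -, rfl⟩ := mem_image.1 hx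
    rcases mem_insert.1 hx' with h | h
    · exact skip_ne_zero _ _ _ h
    · obtain ⟨m, -, h⟩ := mem_image.1 h
      exact skip_ne_max hM σ p m h.symm
  rw [e1, e2, ← sum_insert n0, ← sum_union hd]
  refine sum_congr (Eq.symm (eq_of_subset_of_card_le ?_ ?_)) fun _ _ => rfl
  · intro x hx
    rw [mem_range]
    rcases mem_union.1 hx with h | h
    · obtain ⟨p, hp, rfl⟩ := mem_image.1 h
      rw [mem_range] at hp
      have : p / M ≤ q := Nat.lt_succ_iff.1 (Nat.div_lt_of_lt_mul hp)
      unfold skip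
      split_ifs <;> nlinarith
    · rcases mem_insert.1 h with h | h
      · subst h
        positivity
      · obtain ⟨m, hm, rfl⟩ := mem_image.1 h
        rw [mem_range] at hm
        rw [max_lt_iff]
        constructor <;> nlinarith
  · rw [card_union_of_disjoint hd, card_insert_of_notMem n0,
      card_image_of_injective _ (skip_strictMono M σ).injective,
      card_image_of_injective _ hb.injective]
    simp only [card_range]
    exact le_of_eq (by ring)

theorem sum_range_mul_le {f c : ℕ → ℝ} {t q : ℕ}
    (h : ∀ g < q, ∀ x < t, f (g * t + x) ≤ c g) :
    ∑ p ∈ range (q * t), f p ≤ t * ∑ g ∈ range q, c g := by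
  induction q with
  | zero => simp
  | succ q ih =>
    rw [Nat.succ_mul, sum_range_add, sum_range_succ, mul_add]
    refine add_le_add (ih fun g hg => h g (by omega)) ?_
    refine (sum_le_card_nsmul _ _ (c q) fun x hx => ?_).trans (by simp)
    exact h q (by omega) x (mem_range.1 hx)

/-- `Nourished u N q μ`: for every `r ≤ N`, after discarding the best `N - r` positions, the next
`r * (q + 1)` positions carry total weight at least `r * μ`. -/
def Nourished (u : ℕ → ℝ) (N q : ℕ) (μ : ℝ) : Prop :=
  ∀ r ≤ N, (r : ℝ) * μ ≤ ∑ p ∈ range (r * (q + 1)), u (N - r + p)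

theorem Nourished.comp_skip {u : ℕ → ℝ} (hu : Antitone u) {M q σ : ℕ}
    {μ : ℝ} (hM : 1 ≤ M) (hF : Nourished u (M + 1) q μ)
    (h : M * (q + 1) ≤ σ ∨
      u 0 + ∑ m ∈ range q, u (max (σ + m + 1) ((M + 1) * (m + 1))) < μ) :
    Nourished (u ∘ skip M σ) M q μ := by
  intro r hr
  by_cases hc : M - r + r * (q + 1) ≤ σ
  · refine (hF r (by omega)).trans (le_of_eq (sum_congr rfl fun p hp => ?_))
    rw [mem_range] at hp
    simp only [Function.comp_apply, skip]
    rw [if_pos (by omega)]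
    congr 1
    omega
  · obtain ⟨t, rfl⟩ := Nat.exists_eq_add_of_le hr
    have ht : r + t - r = t := by omega
    rw [ht] at hc ⊢
    have hσ : σ < (r + t) * (q + 1) := by nlinarith
    replace h := h.resolve_left (by omega)
    have hall := hF (r + t + 1) le_rfl
    rw [Nat.sub_self] at hall
    simp only [zero_add] at hall
    rw [sum_range_eq_skip_add hM hσ] at hall
    have hsplit : (r + t) * (q + 1) = t + r * (q + 1) + t * q := by ring
    rw [hsplit, sum_range_add, sum_range_add] at hall
    have htop : ∑ p ∈ range t, u (skip (r + t) σ p) ≤ t * u 0 := by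
      refine (sum_le_card_nsmul _ _ (u 0) fun p _ => hu (Nat.zero_le _)).trans ?_
      simp
    have hlow : ∑ p ∈ range (t * q), u (skip (r + t) σ (t + r * (q + 1) + p)) ≤
        t * ∑ m ∈ range q, u (max (σ + m + 1) ((r + t + 1) * (m + 1))) := by
      rw [mul_comm t q]
      refine sum_range_mul_le fun g hg x hx => hu ?_
      have h1 : (r + t) * (g + 1) ≤ t + r * (q + 1) + (g * t + x) := by nlinarith
      have h2 : g + 1 ≤ (t + r * (q + 1) + (g * t + x)) / (r + t) :=
        (Nat.le_div_iff_mul_le (by omega)).2 (by linarith)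
      have h3 : ¬ t + r * (q + 1) + (g * t + x) < σ := by omega
      rw [skip, if_neg h3, max_le_iff]
      generalize (t + r * (q + 1) + (g * t + x)) / (r + t) = d at *
      constructor <;> nlinarith
    push_cast at hall
    simp only [Function.comp_apply]
    nlinarith

/-- What is fixed for one agent in the ranked instance: `A` is the set of ranks she would like to
consume, `R` the ranks she may pick normally, `c` the only rank for which she may need a copy and
`ν` her turn in the order in which copies are made (the agent with `ν = 1` needs no copy). -/
structure IsPlan (u : ℕ → ℝ) (q : ℕ) (μ : ℝ) (ν c : ℕ) (R A : Finset ℕ) : Prop where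
  subset_insert : A ⊆ insert c R
  card_le : #A ≤ q + 1
  le_sum : μ ≤ ∑ p ∈ A, u p
  subset_of_eq_one : ν = 1 → A ⊆ R
  le_copy : 2 ≤ ν → ν ≤ c
  card_filter_le : 2 ≤ ν → ∀ p, ν < p → #{x ∈ A | x < p} + ν ≤ p + 2

theorem IsPlan.image {u : ℕ → ℝ} {q : ℕ} {μ : ℝ} {ν c : ℕ} {R A : Finset ℕ} {f : ℕ → ℕ}
    (hf : StrictMono f) (h : IsPlan (u ∘ f) q μ ν c R A) :
    IsPlan u q μ ν (f c) (R.image f) (A.image f) where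
  subset_insert := by
    rw [← image_insert]
    exact image_subset_image h.subset_insert
  card_le := card_image_le.trans h.card_le
  le_sum := by
    rw [sum_image hf.injective.injOn]
    exact h.le_sum
  subset_of_eq_one hν := image_subset_image (h.subset_of_eq_one hν)
  le_copy hν := (h.le_copy hν).trans hf.le_apply
  card_filter_le hν p hp := by
    refine le_trans ?_ (h.card_filter_le hν p hp)
    rw [filter_image]
    refine Nat.add_le_add_right (card_image_le.trans (card_le_card fun x hx => ?_)) ν
    rw [mem_filter] at hx ⊢
    exact ⟨hx.1, hf.le_apply.trans_lt hx.2⟩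

/-- The bag of ranks taken by the agent who leaves an instance with `M + 1` agents. -/
def bag (M s q : ℕ) : Finset ℕ :=
  insert 0 ((range q).image fun m => max (s + m + 1) ((M + 1) * (m + 1)))

theorem isPlan_bag {u : ℕ → ℝ} {q M s : ℕ} {μ : ℝ} (hM : 1 ≤ M) (hs : M ≤ s)
    (h : μ ≤ u 0 + ∑ m ∈ range q, u (max (s + m + 1) ((M + 1) * (m + 1)))) :
    IsPlan u q μ (M + 1) (s + 1) ((bag M s q).erase (s + 1)) (bag M s q) where
  subset_insert := insert_erase_subset _ _
  card_le := (card_insert_le _ _).trans (by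
    simpa using (card_image_le (s := range q)
      (f := fun m => max (s + m + 1) ((M + 1) * (m + 1)))))
  le_sum := by
    rw [bag, sum_insert (by simp),
      sum_image (strictMono_max_add_mul (M + 1) s (by omega)).injective.injOn]
    exact h
  subset_of_eq_one hν := by omega
  le_copy _ := by omega
  card_filter_le _ p hp := by
    have : {x ∈ bag M s q | x < p} ⊆ insert 0 (Ico (M + 1) p) := by
      intro x hx
      obtain ⟨hx, hxp⟩ := mem_filter.1 hx
      rcases mem_insert.1 hx with rfl | hx
      · exact mem_insert_self _ _
      · obtain ⟨m, -, rfl⟩ := mem_image.1 hx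
        refine mem_insert_of_mem (mem_Ico.2 ⟨?_, hxp⟩)
        exact le_max_of_le_left (by omega)
    have := (card_le_card this).trans (card_insert_le _ _)
    rw [Nat.card_Ico] at this
    omega

theorem skip_notMem_bag_erase {M s q : ℕ} (hM : 1 ≤ M) (hs : M ≤ s) (p : ℕ) :
    skip M (s + 1) p ∉ (bag M s q).erase (s + 1) := by
  intro h
  obtain ⟨hne, h⟩ := mem_erase.1 h
  rcases mem_insert.1 h with h | h
  · exact skip_ne_zero _ _ _ h
  · obtain ⟨m, -, h⟩ := mem_image.1 h
    have h1 := skip_ne_max hM (s + 1) p m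
    have h2 := skip_ne_max hM (s + 1) p (m - 1)
    rcases m with - | m
    · simp only [zero_add, add_zero, mul_one] at h
      omega
    · rw [Nat.add_sub_cancel] at h2
      have : (M + 1) * (m + 1) ≤ (M + 1) * (m + 1 + 1) := by nlinarith
      have : (M + 1) * (m + 1 + 1) = (M + 1) * (m + 1) + (M + 1) := by ring
      generalize (M + 1) * (m + 1 + 1) = a at *
      generalize (M + 1) * (m + 1) = b at *
      generalize skip M (s + 1) p = d at *
      omega

theorem Nourished.le_sum_bag {u : ℕ → ℝ} (hu : Antitone u) {M q : ℕ} {μ : ℝ}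
    (h : Nourished u (M + 1) q μ) :
    μ ≤ u 0 + ∑ m ∈ range q, u (max (M + m + 1) ((M + 1) * (m + 1))) := by
  have h1 := h (M + 1) le_rfl
  rw [Nat.sub_self, mul_comm (M + 1) (q + 1)] at h1
  have h2 := h1.trans (sum_range_mul_le (c := fun g => u ((M + 1) * g))
    fun g _ x _ => hu (by rw [mul_comm]; omega))
  have h3 := le_of_mul_le_mul_left h2 (by positivity)
  rw [sum_range_succ'] at h3
  have h4 : ∀ m, max (M + m + 1) ((M + 1) * (m + 1)) = (M + 1) * (m + 1) := fun m =>
    max_eq_right (by nlinarith)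
  simp only [h4]
  simpa [add_comm] using h3

theorem exists_leaving_agent {ι : Type*} {T : Finset ι} (hT : T.Nonempty) {q : ι → ℕ}
    {μ : ι → ℝ} {u : ι → ℕ → ℝ} {M : ℕ} (hM : 1 ≤ M) (hu : ∀ i ∈ T, Antitone (u i))
    (hF : ∀ i ∈ T, Nourished (u i) (M + 1) (q i) (μ i)) :
    ∃ s ≥ M, (∃ i ∈ T, μ i ≤ u i 0 +
        ∑ m ∈ range (q i), u i (max (s + m + 1) ((M + 1) * (m + 1)))) ∧
      ∀ i ∈ T, Nourished (u i ∘ skip M (s + 1)) M (q i) (μ i) := by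
  let P : ℕ → Prop := fun s => ∃ i ∈ T, s ≤ M + M * (q i + 1) ∧ μ i ≤ u i 0 +
    ∑ m ∈ range (q i), u i (max (s + m + 1) ((M + 1) * (m + 1)))
  have key : ∃ s ≥ M, P s ∧ ¬ P (s + 1) := by
    by_contra! hcon
    have hall : ∀ s ≥ M, P s := by
      intro s hs
      induction s, hs using Nat.le_induction with
      | base =>
        obtain ⟨i, hi⟩ := hT
        exact ⟨i, hi, by omega, (hF i hi).le_sum_bag (hu i hi)⟩
      | succ s hs ih => exact hcon s hs ih
    obtain ⟨i, hi, h, -⟩ := hall (M + M * (T.sup q + 1) + 1) (by omega)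
    have := Nat.mul_le_mul_left M (Nat.succ_le_succ (le_sup (f := q) hi))
    simp only [Nat.succ_eq_add_one] at this
    omega
  obtain ⟨s, hs, ⟨i, hi, -, h⟩, hnot⟩ := key
  refine ⟨s, hs, ⟨i, hi, h⟩, fun j hj => (hF j hj).comp_skip (hu j hj) hM ?_⟩
  by_contra! hcon
  exact hnot ⟨j, hj, by omega, hcon.2⟩

/-- The ranked instance, in which all agents agree on the order of the goods. -/
theorem exists_plans {ι : Type*} [DecidableEq ι] (q : ι → ℕ) (μ : ι → ℝ) (N : ℕ) :
    ∀ (T : Finset ι) (u : ι → ℕ → ℝ), #T = N → (∀ i ∈ T, Antitone (u i)) →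
      (∀ i ∈ T, Nourished (u i) N (q i) (μ i)) →
      ∃ (ν c : ι → ℕ) (R A : ι → Finset ℕ), Set.InjOn ν T ∧
        (T : Set ι).PairwiseDisjoint R ∧
        ∀ i ∈ T, 1 ≤ ν i ∧ ν i ≤ N ∧ IsPlan (u i) (q i) (μ i) (ν i) (c i) (R i) (A i) := by
  induction N with
  | zero =>
    intro T u hT _ _
    rw [card_eq_zero] at hT
    subst hT
    exact ⟨0, 0, fun _ => ∅, fun _ => ∅, by simp, by simp, by simp⟩
  | succ M ih =>
    intro T u hT hu hF
    rcases Nat.eq_zero_or_pos M with rfl | hM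
    · obtain ⟨i, rfl⟩ := card_eq_one.1 hT
      refine ⟨fun _ => 1, 0, fun i => range (q i + 1), fun i => range (q i + 1), by simp,
        by simp, fun j hj => ⟨le_rfl, le_rfl, ⟨subset_insert _ _, by simp, ?_, fun _ => subset_rfl,
          by simp, by simp⟩⟩⟩
      simpa using hF j hj 1 le_rfl
    · obtain ⟨s, hs, ⟨i, hi, hbag⟩, hF'⟩ :=
        exists_leaving_agent (card_pos.1 (by omega)) hM hu hF
      have hmono := skip_strictMono M (s + 1)
      obtain ⟨ν, c, R, A, hinj, hdisj, hplan⟩ := ih (T.erase i)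
        (fun j => u j ∘ skip M (s + 1)) (by rw [card_erase_of_mem hi]; omega)
        (fun j hj => (hu j (mem_of_mem_erase hj)).comp_monotone hmono.monotone)
        fun j hj => hF' j (mem_of_mem_erase hj)
      have hlt : ∀ j ∈ T, j ≠ i → ν j < M + 1 := fun j hj hji =>
        Nat.lt_succ_of_le (hplan j (mem_erase.2 ⟨hji, hj⟩)).2.1
      have hRi : ∀ j, Disjoint ((bag M s (q i)).erase (s + 1))
          ((R j).image (skip M (s + 1))) := fun j => by
        rw [disjoint_right]
        intro x hx
        obtain ⟨p, -, rfl⟩ := mem_image.1 hx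
        exact skip_notMem_bag_erase hM hs p
      refine ⟨fun j => if j = i then M + 1 else ν j,
        fun j => if j = i then s + 1 else skip M (s + 1) (c j),
        fun j => if j = i then (bag M s (q i)).erase (s + 1) else (R j).image (skip M (s + 1)),
        fun j => if j = i then bag M s (q i) else (A j).image (skip M (s + 1)), ?_, ?_, ?_⟩
      · intro a ha b hb hab
        rw [mem_coe] at ha hb
        by_cases hai : a = i <;> by_cases hbi : b = i <;>
          simp only [hai, hbi, if_true, if_false] at hab
        · rw [hai, hbi]
        · exact absurd hab (hlt b hb hbi).ne'
        · exact absurd hab (hlt a ha hai).ne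
        · exact hinj (mem_erase.2 ⟨hai, ha⟩) (mem_erase.2 ⟨hbi, hb⟩) hab
      · intro a ha b hb hab
        rw [mem_coe] at ha hb
        simp only [Function.onFun]
        by_cases hai : a = i <;> by_cases hbi : b = i <;> simp only [hai, hbi, if_true, if_false]
        · exact absurd (hai.trans hbi.symm) hab
        · exact hRi b
        · exact (hRi a).symm
        · exact (disjoint_image hmono.injective).2
            (hdisj (mem_erase.2 ⟨hai, ha⟩) (mem_erase.2 ⟨hbi, hb⟩) hab)
      · intro j hj
        by_cases hji : j = i
        · subst hji
          simp only [if_true]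
          exact ⟨by omega, le_rfl, isPlan_bag hM hs hbag⟩
        · simp only [hji, if_false]
          obtain ⟨h1, h2, h3⟩ := hplan j (mem_erase.2 ⟨hji, hj⟩)
          exact ⟨h1, by omega, h3.image hmono⟩

theorem exists_subset_sum_le_of_card_filter_le {u : ℕ → ℝ} (hu : Antitone u) (A : Finset ℕ) :
    ∀ S : Finset ℕ, (∀ p, #{x ∈ A | x < p} ≤ #{x ∈ S | x < p}) →
      ∃ T ⊆ S, #T = #A ∧ ∑ p ∈ A, u p ≤ ∑ p ∈ T, u p := by
  induction A using Finset.induction_on_max with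
  | empty => exact fun S _ => ⟨∅, empty_subset _, rfl, le_rfl⟩
  | insert a A ha ih =>
    intro S hS
    have haA : a ∉ A := fun h => lt_irrefl a (ha a h)
    obtain ⟨T, hTS, hcard, hsum⟩ := ih S fun p =>
      (card_le_card (filter_subset_filter _ (subset_insert a A))).trans (hS p)
    have h1 := hS (a + 1)
    rw [filter_true_of_mem (fun x hx => ?_), card_insert_of_notMem haA, ← hcard] at h1
    · obtain ⟨s, hs, hsT⟩ := exists_mem_notMem_of_card_lt_card (Nat.lt_of_succ_le h1)
      rw [mem_filter] at hs
      refine ⟨insert s T, insert_subset hs.1 hTS, ?_, ?_⟩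
      · rw [card_insert_of_notMem hsT, card_insert_of_notMem haA, hcard]
      · rw [sum_insert haA, sum_insert hsT]
        exact add_le_add (hu (by omega)) hsum
    · rcases mem_insert.1 hx with rfl | hx
      · omega
      · have := ha x hx
        omega

theorem sum_le_sum_range_add {u : ℕ → ℝ} (hu : Antitone u) (hu0 : ∀ p, 0 ≤ u p) {A : Finset ℕ}
    {a c : ℕ} (ha : ∀ x ∈ A, a ≤ x) (hc : #A ≤ c) :
    ∑ p ∈ A, u p ≤ ∑ p ∈ range c, u (a + p) := by
  obtain ⟨T, hTS, -, hsum⟩ := exists_subset_sum_le_of_card_filter_le hu A (Ico a (a + c)) fun p => by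
    have h1 : #{x ∈ A | x < p} ≤ #(Ico a p) := card_le_card fun x hx => by
      rw [mem_filter] at hx
      exact mem_Ico.2 ⟨ha x hx.1, hx.2⟩
    have h2 := card_filter_le A (· < p)
    have h3 : {x ∈ Ico a (a + c) | x < p} = Ico a (min (a + c) p) := by
      ext x
      simp only [mem_filter, mem_Ico, lt_min_iff, and_assoc]
    rw [h3, Nat.card_Ico]
    rw [Nat.card_Ico] at h1
    omega
  have h := sum_le_sum_of_subset_of_nonneg hTS fun p _ _ => hu0 p
  rw [sum_Ico_eq_sum_range, Nat.add_sub_cancel_left] at h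
  exact hsum.trans h

/-- `ρ` ranks the goods by decreasing weight, and `u p` is the weight of the good of rank `p`. -/
structure IsRanking {G : Type*} [Fintype G] (w : G → ℝ) (ρ : G → ℕ) (u : ℕ → ℝ) : Prop where
  injective : Function.Injective ρ
  lt_card : ∀ g, ρ g < Fintype.card G
  antitone : Antitone u
  nonneg : ∀ p, 0 ≤ u p
  apply_rank : ∀ g, u (ρ g) = w g
  eq_zero : ∀ p, Fintype.card G ≤ p → u p = 0

theorem exists_isRanking {G : Type*} [Fintype G] (w : G → ℝ) (hw : ∀ g, 0 ≤ w g) :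
    ∃ ρ u, IsRanking w ρ u := by
  let e := Fintype.equivFin G
  let f : Fin (Fintype.card G) → ℝ := fun x => -w (e.symm x)
  let τ := Tuple.sort f
  have hτ : Monotone (f ∘ τ) := Tuple.monotone_sort f
  refine ⟨fun g => τ.symm (e g),
    fun p => if h : p < Fintype.card G then w (e.symm (τ ⟨p, h⟩)) else 0, ?_, ?_, ?_, ?_, ?_, ?_⟩
  · exact Fin.val_injective.comp (τ.symm.injective.comp e.injective)
  · exact fun g => Fin.is_lt _
  · intro a b hab
    dsimp only
    split_ifs with hb ha
    · have := hτ (show (⟨a, ha⟩ : Fin _) ≤ ⟨b, hb⟩ from hab)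
      exact neg_le_neg_iff.1 this
    · omega
    · exact hw _
    · exact le_rfl
  · intro p
    split_ifs
    exacts [hw _, le_rfl]
  · intro g
    simp
  · intro p hp
    simp [hp]

theorem IsRanking.card_filter_lt {G : Type*} [Fintype G] {w : G → ℝ} {ρ : G → ℕ} {u : ℕ → ℝ}
    (h : IsRanking w ρ u) {p : ℕ} (hp : p ≤ Fintype.card G) : #{g | ρ g < p} = p := by
  classical
  have himg : univ.image ρ = range (Fintype.card G) :=
    eq_of_subset_of_card_le (fun x hx => by
      obtain ⟨g, -, rfl⟩ := mem_image.1 hx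
      exact mem_range.2 (h.lt_card g))
      (by rw [card_image_of_injective _ h.injective, card_range, card_univ])
  have himg' : ({g | ρ g < p} : Finset G).image ρ = range p := by
    ext x
    refine ⟨fun hx => ?_, fun hx => ?_⟩
    · obtain ⟨g, hg, rfl⟩ := mem_image.1 hx
      exact mem_range.2 (mem_filter.1 hg).2
    · obtain ⟨g, -, rfl⟩ := mem_image.1
        (himg.ge (mem_range.2 ((mem_range.1 hx).trans_le hp)))
      exact mem_image_of_mem ρ (mem_filter.2 ⟨mem_univ g, mem_range.1 hx⟩)
  rw [← card_image_of_injective _ h.injective, himg', card_range]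

theorem sum_le_kDemand {G : Type*} [DecidableEq G] {w : G → ℝ} {k : ℕ} {S T : Finset G}
    (hTS : T ⊆ S) (hT : #T ≤ k) : ∑ g ∈ T, w g ≤ kDemand w k S :=
  le_sup' (fun T => ∑ g ∈ T, w g) (mem_filter.2 ⟨mem_powerset.2 hTS, hT⟩)

theorem exists_sum_eq_kDemand {G : Type*} [DecidableEq G] (w : G → ℝ) (k : ℕ) (S : Finset G) :
    ∃ T ⊆ S, #T ≤ k ∧ ∑ g ∈ T, w g = kDemand w k S := by
  obtain ⟨T, hT, h⟩ := exists_mem_eq_sup' (s := S.powerset.filter fun T => #T ≤ k)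
    ⟨∅, by simp⟩ (fun T => ∑ g ∈ T, w g)
  rw [mem_filter, mem_powerset] at hT
  exact ⟨T, hT.1, hT.2, h.symm⟩

theorem exists_partition_mms_le {G : Type*} [Fintype G] [DecidableEq G] (v : Finset G → ℝ) {d : ℕ}
    (hd : 0 < d) :
    ∃ P : G → Fin d, ∀ j, mms v d univ ≤ v (univ.filter fun g => P g = j) := by
  have : Nonempty (Fin d) := ⟨⟨0, hd⟩⟩
  obtain ⟨P, hP⟩ := exists_eq_ciSup_of_finite
    (f := fun P : G → Fin d => ⨅ j : Fin d, v (univ.filter fun g => P g = j))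
  exact ⟨P, fun j => hP.symm.le.trans (ciInf_le (Set.finite_range _).bddBelow j)⟩

theorem IsRanking.nourished_mms {G : Type*} [Fintype G] [DecidableEq G] {w : G → ℝ} {ρ : G → ℕ}
    {u : ℕ → ℝ} (h : IsRanking w ρ u) {n : ℕ} (hn : 0 < n) (q : ℕ) :
    Nourished u n q (mms (kDemand w (q + 1)) n univ) := by
  intro r hr
  obtain ⟨P, hP⟩ := exists_partition_mms_le (kDemand w (q + 1)) hn (G := G)
  choose T hTP hTk hTsum using fun j =>
    exists_sum_eq_kDemand w (q + 1) (univ.filter fun g => P g = j)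
  have hPT : ∀ j, ∀ g ∈ T j, P g = j := fun j g hg => (mem_filter.1 (hTP j hg)).2
  have hE : #(({g | ρ g < n - r} : Finset G).image P) ≤ n - r := by
    refine card_image_le.trans ?_
    rw [← card_image_of_injective _ h.injective]
    refine (card_le_card (t := range (n - r)) fun x hx => ?_).trans (card_range _).le
    obtain ⟨g, hg, rfl⟩ := mem_image.1 hx
    exact mem_range.2 (mem_filter.1 hg).2
  obtain ⟨J, hJE, hJ⟩ := exists_subset_card_eq
    (s := (({g | ρ g < n - r} : Finset G).image P)ᶜ) (n := r)
    (by rw [card_compl, Fintype.card_fin]; omega)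
  have hdisj : (J : Set (Fin n)).PairwiseDisjoint T := fun a _ b _ hab => by
    rw [Function.onFun, disjoint_left]
    exact fun g hga hgb => hab ((hPT a g hga).symm.trans (hPT b g hgb))
  have hlow : (r : ℝ) * mms (kDemand w (q + 1)) n univ ≤ ∑ g ∈ J.biUnion T, w g := by
    rw [sum_biUnion hdisj]
    simpa [hJ] using card_nsmul_le_sum J (fun j => ∑ g ∈ T j, w g) _ fun j _ =>
      (hP j).trans (hTsum j).ge
  have himg : ∑ g ∈ J.biUnion T, w g = ∑ p ∈ (J.biUnion T).image ρ, u p := by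
    rw [sum_image h.injective.injOn]
    exact sum_congr rfl fun g _ => (h.apply_rank g).symm
  refine (hlow.trans himg.le).trans (sum_le_sum_range_add h.antitone h.nonneg ?_ ?_)
  · intro x hx
    obtain ⟨g, hg, rfl⟩ := mem_image.1 hx
    obtain ⟨j, hj, hgj⟩ := mem_biUnion.1 hg
    by_contra! hlt
    have h1 := mem_compl.1 (hJE hj)
    exact h1 (mem_image.2 ⟨g, by simpa using hlt, hPT j g hgj⟩)
  · refine card_image_le.trans (card_biUnion_le.trans ?_)
    simpa [hJ] using sum_le_card_nsmul J (fun j => #(T j)) (q + 1) fun j _ => hTk j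

theorem IsRanking.sum_le_kDemand_of_card_filter_le {G : Type*} [Fintype G] [DecidableEq G]
    {w : G → ℝ} {ρ : G → ℕ} {u : ℕ → ℝ} (h : IsRanking w ρ u) {k : ℕ} {A : Finset ℕ}
    (hA : #A ≤ k) {S : Finset G}
    (hS : ∀ p ≤ Fintype.card G, #{x ∈ A | x < p} ≤ #{g ∈ S | ρ g < p}) :
    ∑ p ∈ A, u p ≤ kDemand w k S := by
  obtain ⟨T, hTS, hTA, hsum⟩ := exists_subset_sum_le_of_card_filter_le h.antitone
    {x ∈ A | x < Fintype.card G} (S.image ρ) fun p => by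
      rw [filter_image, card_image_of_injective _ h.injective, filter_filter]
      have := hS (min p (Fintype.card G)) (min_le_right _ _)
      simp only [lt_min_iff, h.lt_card, and_true] at this
      simpa only [and_comm] using this
  have hcut : ∑ p ∈ A, u p = ∑ p ∈ A with p < Fintype.card G, u p := by
    refine (sum_filter_of_ne fun p _ hp => ?_).symm
    by_contra! hle
    exact hp (h.eq_zero p hle)
  obtain ⟨T', hT', rfl⟩ := subset_image_iff.1 hTS
  rw [card_image_of_injective _ h.injective] at hTA
  rw [sum_image h.injective.injOn, sum_congr rfl fun g _ => h.apply_rank g] at hsum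
  rw [hcut]
  exact hsum.trans (sum_le_kDemand (by exact_mod_cast hT')
    (hTA.trans_le ((card_filter_le _ _).trans hA)))

/-- Without copies, the agents can pick goods so that each of them is at least as well off as in
the ranked instance. -/
theorem exists_picks {ι G : Type*} [Fintype ι] [DecidableEq ι] [Fintype G] [DecidableEq G]
    {ρ : ι → G → ℕ} (hρ : ∀ i, ∀ p ≤ Fintype.card G, #{g | ρ i g < p} = p)
    {R : ι → Finset ℕ} (hR : Pairwise fun i j => Disjoint (R i) (R j)) {p : ℕ}
    (hp : p ≤ Fintype.card G) :
    ∃ B : ι → Finset G, (Pairwise fun i j => Disjoint (B i) (B j)) ∧ #(univ.biUnion B) ≤ p ∧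
      ∀ i, ∀ t ≤ p, #{x ∈ R i | x < t} ≤ #{g ∈ B i | ρ i g < t} := by
  induction p with
  | zero => exact ⟨fun _ => ∅, by simp [Pairwise], by simp [eq_empty_iff_forall_notMem], by simp⟩
  | succ p ih =>
    obtain ⟨B, hB, hcard, hcount⟩ := ih (by omega)
    by_cases hex : ∃ i, p ∈ R i
    · obtain ⟨i, hi⟩ := hex
      obtain ⟨g, hg, hgB⟩ := exists_mem_notMem_of_card_lt_card
        (s := univ.biUnion B) (t := {g | ρ i g < p + 1}) (by rw [hρ i _ hp]; omega)
      have hgB' : ∀ j, g ∉ B j := fun j hj => hgB (mem_biUnion.2 ⟨j, mem_univ j, hj⟩)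
      have hgp : ρ i g < p + 1 := (mem_filter.1 hg).2
      have hsub : ∀ j, B j ⊆ Function.update B i (insert g (B i)) j := fun j => by
        by_cases hj : j = i
        · subst hj
          simp
        · simp [hj]
      refine ⟨Function.update B i (insert g (B i)), ?_, ?_, ?_⟩
      · intro a b hab
        by_cases ha : a = i
        · subst ha
          simpa [hab.symm, hgB' b] using hB hab
        · by_cases hb : b = i
          · subst hb
            simpa [ha, hgB' a] using hB hab
          · simpa [ha, hb] using hB hab
      · refine (card_le_card (t := insert g (univ.biUnion B)) fun x hx => ?_).trans
          ((card_insert_le _ _).trans (by omega))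
        obtain ⟨j, -, hj⟩ := mem_biUnion.1 hx
        by_cases hji : j = i
        · subst hji
          rw [Function.update_self] at hj
          rcases mem_insert.1 hj with rfl | hj
          · exact mem_insert_self _ _
          · exact mem_insert_of_mem (mem_biUnion.2 ⟨j, mem_univ j, hj⟩)
        · rw [Function.update_of_ne hji] at hj
          exact mem_insert_of_mem (mem_biUnion.2 ⟨j, mem_univ j, hj⟩)
      · intro j t ht
        rcases Nat.lt_or_ge t (p + 1) with htp | htp
        · exact (hcount j t (by omega)).trans (card_le_card (filter_subset_filter _ (hsub j)))
        · obtain rfl : t = p + 1 := by omega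
          have h0 := hcount j p le_rfl
          by_cases hj : j = i
          · subst hj
            rw [Function.update_self, filter_insert, if_pos hgp,
              card_insert_of_notMem fun hx => hgB' j (mem_filter.1 hx).1]
            have h1 : {x ∈ R j | x < p + 1} ⊆ insert p {x ∈ R j | x < p} := fun x hx => by
              obtain ⟨hxR, hxp⟩ := mem_filter.1 hx
              rcases Nat.lt_succ_iff_lt_or_eq.1 hxp with hlt | rfl
              · exact mem_insert_of_mem (mem_filter.2 ⟨hxR, hlt⟩)
              · exact mem_insert_self _ _
            have h2 : #{g ∈ B j | ρ j g < p} ≤ #{g ∈ B j | ρ j g < p + 1} :=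
              card_le_card (monotone_filter_right _ fun _ _ h => Nat.lt_succ_of_lt h)
            have := (card_le_card h1).trans (card_insert_le _ _)
            omega
          · have hpj : p ∉ R j := fun h => disjoint_left.1 (hR hj) h hi
            rw [Function.update_of_ne hj]
            refine le_trans (card_le_card fun x hx => ?_) (h0.trans
              (card_le_card (monotone_filter_right _ fun _ _ h => Nat.lt_succ_of_lt h)))
            rw [mem_filter] at hx ⊢
            refine ⟨hx.1, lt_of_le_of_ne (Nat.le_of_lt_succ hx.2) ?_⟩
            rintro rfl
            exact hpj hx.1
    · push Not at hex
      refine ⟨B, hB, by omega, fun j t ht => ?_⟩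
      rcases Nat.lt_or_ge t (p + 1) with htp | htp
      · exact hcount j t (by omega)
      · obtain rfl : t = p + 1 := by omega
        refine le_trans (card_le_card fun x hx => ?_) ((hcount j p le_rfl).trans
          (card_le_card (monotone_filter_right _ fun _ _ h => Nat.lt_succ_of_lt h)))
        rw [mem_filter] at hx ⊢
        refine ⟨hx.1, lt_of_le_of_ne (Nat.le_of_lt_succ hx.2) ?_⟩
        rintro rfl
        exact hex j hx.1

theorem IsPlan.exists_copy {G : Type*} [Fintype G] [DecidableEq G] {ρ : G → ℕ}
    (hρ : ∀ p ≤ Fintype.card G, #{g | ρ g < p} = p) {u : ℕ → ℝ} {q : ℕ} {μ : ℝ} {ν c : ℕ}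
    {R A : Finset ℕ} (h : IsPlan u q μ ν c R A) (hν : 1 ≤ ν) {B C : Finset G}
    (hB : ∀ p ≤ Fintype.card G, #{x ∈ R | x < p} ≤ #{g ∈ B | ρ g < p}) (hC : #C ≤ ν - 2) :
    ∃ Y : Finset G, #Y ≤ 1 ∧ #Y ≤ ν - 1 ∧ Disjoint Y C ∧
      ∀ p ≤ Fintype.card G, #{x ∈ A | x < p} ≤ #{g ∈ B ∪ Y | ρ g < p} := by
  rcases hν.eq_or_lt with hν | hν
  · refine ⟨∅, by simp, by simp, by simp, fun p hp => ?_⟩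
    rw [union_empty]
    exact (card_le_card (filter_subset_filter _ (h.subset_of_eq_one hν.symm))).trans (hB p hp)
  obtain ⟨Y, hY, hYC, hgood⟩ : ∃ Y : Finset G, #Y ≤ 1 ∧ Disjoint Y C ∧
      ∀ p, (∃ g ∈ Y, g ∉ B ∧ ρ g < p) ∨ ∀ g, ρ g < p → g ∈ B ∪ C := by
    rcases ((B ∪ C)ᶜ).eq_empty_or_nonempty with he | hne
    · refine ⟨∅, by simp, by simp, fun p => Or.inr fun g _ => ?_⟩
      rw [compl_eq_empty_iff] at he
      exact he ▸ mem_univ g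
    · obtain ⟨g, hg, hmin⟩ := exists_min_image _ ρ hne
      rw [mem_compl, mem_union, not_or] at hg
      refine ⟨{g}, by simp, by simpa using hg.2, fun p => ?_⟩
      by_cases hgp : ρ g < p
      · exact Or.inl ⟨g, mem_singleton_self g, hg.1, hgp⟩
      · refine Or.inr fun x hx => ?_
        by_contra hxn
        exact hgp ((hmin x (mem_compl.2 hxn)).trans_lt hx)
  refine ⟨Y, hY, by omega, hYC, fun p hp => ?_⟩
  have hRB := hB p hp
  have hBY : #{g ∈ B | ρ g < p} ≤ #{g ∈ B ∪ Y | ρ g < p} :=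
    card_le_card (filter_subset_filter _ subset_union_left)
  have hmem : ∀ x ∈ A, x = c ∨ x ∈ R := fun x hx => mem_insert.1 (h.subset_insert hx)
  rcases Nat.lt_or_ge c p with hcp | hcp
  · rcases hgood p with ⟨g, hgY, hgB, hgp⟩ | hall
    · have h1 : {x ∈ A | x < p} ⊆ insert c {x ∈ R | x < p} := fun x hx => by
        obtain ⟨hxA, hxp⟩ := mem_filter.1 hx
        exact mem_insert.2 ((hmem x hxA).imp_right fun hxR => mem_filter.2 ⟨hxR, hxp⟩)
      have h2 : insert g {g ∈ B | ρ g < p} ⊆ {g ∈ B ∪ Y | ρ g < p} :=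
        insert_subset (mem_filter.2 ⟨mem_union_right _ hgY, hgp⟩)
          (filter_subset_filter _ subset_union_left)
      have h3 := card_le_card h2
      rw [card_insert_of_notMem fun hx => hgB (mem_filter.1 hx).1] at h3
      have h4 := (card_le_card h1).trans (card_insert_le _ _)
      omega
    · have h1 : ({g | ρ g < p} : Finset G) ⊆ {g ∈ B | ρ g < p} ∪ C := fun g hg => by
        have hgp := (mem_filter.1 hg).2
        exact mem_union.2 ((mem_union.1 (hall g hgp)).imp_left fun hgB =>
          mem_filter.2 ⟨hgB, hgp⟩)
      have h2 := (card_le_card h1).trans (card_union_le _ _)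
      rw [hρ p hp] at h2
      have h3 := h.card_filter_le hν p ((h.le_copy hν).trans_lt hcp)
      omega
  · refine le_trans (card_le_card fun x hx => ?_) (hRB.trans hBY)
    obtain ⟨hxA, hxp⟩ := mem_filter.1 hx
    exact mem_filter.2 ⟨(hmem x hxA).resolve_left (by omega), hxp⟩

/-- The agents add their copies in the order prescribed by `ν`. -/
theorem exists_copies {ι G : Type*} [Fintype ι] [DecidableEq ι] [Fintype G] [DecidableEq G]
    {ρ : ι → G → ℕ} (hρ : ∀ i, ∀ p ≤ Fintype.card G, #{g | ρ i g < p} = p)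
    {u : ι → ℕ → ℝ} {q : ι → ℕ} {μ : ι → ℝ} {ν c : ι → ℕ} {R A : ι → Finset ℕ}
    (hinj : Function.Injective ν) (hν : ∀ i, 1 ≤ ν i)
    (h : ∀ i, IsPlan (u i) (q i) (μ i) (ν i) (c i) (R i) (A i)) {B : ι → Finset G}
    (hB : ∀ i, ∀ p ≤ Fintype.card G, #{x ∈ R i | x < p} ≤ #{g ∈ B i | ρ i g < p}) (N : ℕ) :
    ∃ X : ι → Finset G, (Pairwise fun i j => Disjoint (X i) (X j)) ∧
      #(univ.biUnion X) ≤ N - 1 ∧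
      ∀ i, ν i ≤ N → ∀ p ≤ Fintype.card G,
        #{x ∈ A i | x < p} ≤ #{g ∈ B i ∪ X i | ρ i g < p} := by
  induction N with
  | zero =>
    refine ⟨fun _ => ∅, by simp [Pairwise], by simp [eq_empty_iff_forall_notMem], fun i hi => ?_⟩
    have := hν i
    omega
  | succ N ih =>
    obtain ⟨X, hX, hcard, hcount⟩ := ih
    by_cases hex : ∃ i, ν i = N + 1
    · obtain ⟨i, hi⟩ := hex
      obtain ⟨Y, hY, hYν, hYC, hYcount⟩ := (h i).exists_copy (hρ i) (hν i) (hB i)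
        (C := univ.biUnion X) (by omega)
      have hYX : ∀ j, Disjoint Y (X j) := fun j =>
        hYC.mono_right (subset_biUnion_of_mem X (mem_univ j))
      refine ⟨Function.update X i Y, ?_, ?_, ?_⟩
      · intro a b hab
        by_cases ha : a = i
        · subst ha
          simpa [hab.symm] using hYX b
        · by_cases hb : b = i
          · subst hb
            simpa [ha] using (hYX a).symm
          · simpa [ha, hb] using hX hab
      · refine (card_le_card (t := Y ∪ univ.biUnion X) fun x hx => ?_).trans
          ((card_union_le _ _).trans (by omega))
        obtain ⟨j, -, hj⟩ := mem_biUnion.1 hx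
        by_cases hji : j = i
        · subst hji
          rw [Function.update_self] at hj
          exact mem_union_left _ hj
        · rw [Function.update_of_ne hji] at hj
          exact mem_union_right _ (mem_biUnion.2 ⟨j, mem_univ j, hj⟩)
      · intro j hj
        by_cases hji : j = i
        · subst hji
          rwa [Function.update_self]
        · rw [Function.update_of_ne hji]
          refine hcount j ?_
          have : ν j ≠ ν i := fun hji' => hji (hinj hji')
          omega
    · push Not at hex
      refine ⟨X, hX, by omega, fun i hi => hcount i ?_⟩
      have := hex i
      omega

theorem card_filter_mem_le_one {ι G : Type*} [Fintype ι] [DecidableEq G] {B : ι → Finset G}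
    (hB : Pairwise fun i j => Disjoint (B i) (B j)) (g : G) : #{i | g ∈ B i} ≤ 1 := by
  refine card_le_one.2 fun a ha b hb => ?_
  by_contra hab
  exact disjoint_left.1 (hB hab) (mem_filter.1 ha).2 (mem_filter.1 hb).2

/-- For `k`-demand valuations, `n − 1` distinct copies suffice for a full MMS
allocation: there is an allocation with copies giving each agent her MMS, in which every
good belongs to at most two bundles and at most `n − 1` goods belong to two bundles. -/
theorem stmt19 {G : Type*} [Fintype G] [DecidableEq G] (n : ℕ)
    (k : Fin n → ℕ) (hk : ∀ i, 0 < k i)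
    (w : Fin n → G → ℝ) (hw : ∀ i g, 0 ≤ w i g) :
    ∃ A : Fin n → Finset G,
      (∀ i, mms (kDemand (w i) (k i)) n Finset.univ ≤ kDemand (w i) (k i) (A i)) ∧
      (∀ g : G, (Finset.univ.filter fun i => g ∈ A i).card ≤ 2) ∧
      (Finset.univ.filter fun g : G =>
        (Finset.univ.filter fun i => g ∈ A i).card = 2).card ≤ n - 1 := by
  choose ρ u hu using fun i => exists_isRanking (w i) (hw i)
  have hF : ∀ i, Nourished (u i) n (k i - 1) (mms (kDemand (w i) (k i)) n univ) := fun i => by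
    have := (hu i).nourished_mms i.pos (k i - 1)
    rwa [Nat.sub_add_cancel (hk i)] at this
  obtain ⟨ν, c, R, A, hinj, hR, hplan⟩ := exists_plans (fun i => k i - 1) _ n univ u
    (by simp) (fun i _ => (hu i).antitone) fun i _ => hF i
  have hρ : ∀ i, ∀ p ≤ Fintype.card G, #{g | ρ i g < p} = p := fun i p hp =>
    (hu i).card_filter_lt hp
  obtain ⟨B, hB, -, hBcount⟩ := exists_picks hρ
    (fun i j hij => hR (mem_coe.2 (mem_univ i)) (mem_coe.2 (mem_univ j)) hij) le_rfl
  obtain ⟨X, hX, hXcard, hXcount⟩ := exists_copies hρ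
    (fun i j hij => hinj (mem_coe.2 (mem_univ i)) (mem_coe.2 (mem_univ j)) hij)
    (fun i => (hplan i (mem_univ i)).1) (fun i => (hplan i (mem_univ i)).2.2) hBcount n
  have hunion : ∀ g, #{i | g ∈ B i ∪ X i} ≤ #{i | g ∈ B i} + #{i | g ∈ X i} := fun g => by
    simp only [mem_union, filter_or]
    exact card_union_le _ _
  have hB1 := card_filter_mem_le_one hB
  have hX1 := card_filter_mem_le_one hX
  refine ⟨fun i => B i ∪ X i, fun i => ?_,
    fun g => (hunion g).trans (Nat.add_le_add (hB1 g) (hX1 g)), ?_⟩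
  · obtain ⟨-, hνn, hp⟩ := hplan i (mem_univ i)
    exact hp.le_sum.trans ((hu i).sum_le_kDemand_of_card_filter_le
      (hp.card_le.trans (Nat.sub_add_cancel (hk i)).le) (hXcount i hνn))
  · refine (card_le_card fun g hg => ?_).trans hXcard
    have h2 : 2 ≤ #{i | g ∈ B i} + #{i | g ∈ X i} := (mem_filter.1 hg).2.ge.trans (hunion g)
    have h3 := hB1 g
    obtain ⟨i, hi⟩ := card_pos.1 (show 0 < #{i | g ∈ X i} by omega)
    exact mem_biUnion.2 ⟨i, mem_univ i, (mem_filter.1 hi).2⟩
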